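/- Let k(v, v*) = c |v - v*|^{-2+γ} exp(-|v-v*|²/8 - ||v|² - |v*|²|²/(8|v-v*|²)) for v ≠ v*, with 0 ≤ γ ≤ 1 and c > 0. Then there exists C > 0 such that for all v ∈ ℝ³, ∫_{ℝ³} k(v, v*) dv* ≤ C (1 + |v|)^{-1}. -/

import Mathlib

open Real MeasureTheory Set
open scoped ENNReal

/-- Integrating a function of `√(x² + |y|²)` over the plane `y ∈ ℝ²`, with `r = √(x² + |y|²)` as
the radial variable. -/
lemma lintegral_plane_comp_sqrt_le (x : ℝ) {h : ℝ → ℝ≥0∞} (hh : Measurable h) :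
    ∫⁻ p : ℝ × ℝ, h √(x ^ 2 + p.1 ^ 2 + p.2 ^ 2)
      ≤ ENNReal.ofReal (2 * π) * ∫⁻ r in Ioi (0 : ℝ), ENNReal.ofReal r * h r := by
  have polar : ∫⁻ p : ℝ × ℝ, h √(x ^ 2 + p.1 ^ 2 + p.2 ^ 2)
      = (∫⁻ ρ in Ioi (0 : ℝ), ENNReal.ofReal ρ * h √(x ^ 2 + ρ ^ 2)) * ENNReal.ofReal (2 * π) := by
    rw [← lintegral_comp_polarCoord_symm, polarCoord_target]
    have key : ∀ p : ℝ × ℝ, ENNReal.ofReal p.1 •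
        h √(x ^ 2 + (polarCoord.symm p).1 ^ 2 + (polarCoord.symm p).2 ^ 2)
        = (ENNReal.ofReal p.1 * h √(x ^ 2 + p.1 ^ 2)) * (fun _ : ℝ => (1 : ℝ≥0∞)) p.2 := by
      intro p
      rw [polarCoord_symm_apply, smul_eq_mul, mul_one]
      congr 3
      linear_combination p.1 ^ 2 * Real.sin_sq_add_cos_sq p.2
    simp_rw [key]
    rw [Measure.volume_eq_prod, ← Measure.prod_restrict,
      lintegral_prod_mul (f := fun ρ => ENNReal.ofReal ρ * h √(x ^ 2 + ρ ^ 2))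
        (g := fun _ => (1 : ℝ≥0∞)) (by fun_prop) (by fun_prop)]
    rw [lintegral_const, one_mul, Measure.restrict_apply_univ, Real.volume_Ioo]
    congr 2
    ring
  rw [polar, mul_comm]
  refine mul_le_mul_right ?_ _
  have pos : ∀ ρ ∈ Ioi (0 : ℝ), 0 < x ^ 2 + ρ ^ 2 := fun ρ hρ => by
    have : 0 < ρ := hρ
    positivity
  have deriv : ∀ ρ ∈ Ioi (0 : ℝ), HasDerivWithinAt (fun ρ => √(x ^ 2 + ρ ^ 2))
      (ρ / √(x ^ 2 + ρ ^ 2)) (Ioi 0) ρ := fun ρ hρ => by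
    have h1 : HasDerivAt (fun ρ : ℝ => x ^ 2 + ρ ^ 2) (2 * ρ) ρ := by
      simpa using (hasDerivAt_pow 2 ρ).const_add (x ^ 2)
    have h2 := (h1.sqrt (pos ρ hρ).ne').hasDerivWithinAt (s := Ioi 0)
    rwa [mul_div_mul_left _ _ two_ne_zero] at h2
  have inj : InjOn (fun ρ : ℝ => √(x ^ 2 + ρ ^ 2)) (Ioi 0) := fun a ha b hb hab => by
    have := (Real.sqrt_inj (pos a ha).le (pos b hb).le).1 hab
    exact (pow_left_inj₀ (le_of_lt ha) (le_of_lt hb) two_ne_zero).1 (by linarith)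
  calc ∫⁻ ρ in Ioi (0 : ℝ), ENNReal.ofReal ρ * h √(x ^ 2 + ρ ^ 2)
      = ∫⁻ ρ in Ioi (0 : ℝ), ENNReal.ofReal |ρ / √(x ^ 2 + ρ ^ 2)| *
          (ENNReal.ofReal √(x ^ 2 + ρ ^ 2) * h √(x ^ 2 + ρ ^ 2)) := by
        refine setLIntegral_congr_fun measurableSet_Ioi fun ρ hρ => ?_
        have hs : 0 < √(x ^ 2 + ρ ^ 2) := Real.sqrt_pos.2 (pos ρ hρ)
        have hρ' : 0 < ρ := hρ
        rw [← mul_assoc, ← ENNReal.ofReal_mul (abs_nonneg _), abs_of_pos (by positivity),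
          div_mul_cancel₀ _ hs.ne']
    _ = ∫⁻ r in (fun ρ : ℝ => √(x ^ 2 + ρ ^ 2)) '' Ioi 0, ENNReal.ofReal r * h r :=
        (lintegral_image_eq_lintegral_abs_deriv_mul measurableSet_Ioi deriv inj
          fun r => ENNReal.ofReal r * h r).symm
    _ ≤ ∫⁻ r in Ioi (0 : ℝ), ENNReal.ofReal r * h r := by
        refine lintegral_mono_set ?_
        rintro _ ⟨ρ, hρ, rfl⟩
        exact Real.sqrt_pos.2 (pos ρ hρ)

/-- The integral over `ℝ³` of a function of `⟪e, z⟫` and `‖z‖`, where `e` is a unit vector. -/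
lemma lintegral_comp_inner_norm_le {e : EuclideanSpace ℝ (Fin 3)} (he : ‖e‖ = 1)
    {F : ℝ × ℝ → ℝ≥0∞} (hF : Measurable F) :
    ∫⁻ z, F (inner ℝ e z, ‖z‖)
      ≤ ENNReal.ofReal (2 * π) * ∫⁻ x : ℝ, ∫⁻ r in Ioi (0 : ℝ), ENNReal.ofReal r * F (x, r) := by
  obtain ⟨b, hb⟩ := Orthonormal.exists_orthonormalBasis_extension_of_card_eq
    (𝕜 := ℝ) (ι := Fin 3) (v := fun _ : Fin 3 => e) (s := {0}) (by simp)
    (by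
      rw [orthonormal_iff_ite]
      rintro ⟨i, rfl⟩ ⟨j, rfl⟩
      simp [he])
  have hb0 : b 0 = e := hb 0 rfl
  have coord : ∀ z, F (inner ℝ e z, ‖z‖)
      = F (b.repr z 0, √(b.repr z 0 ^ 2 + b.repr z 1 ^ 2 + b.repr z 2 ^ 2)) := fun z => by
    rw [← b.repr.norm_map z, EuclideanSpace.norm_eq, ← hb0, ← b.repr_apply_apply]
    simp [Fin.sum_univ_three]
  simp_rw [coord]
  have e1 := (b.measurePreserving_repr).lintegral_comp
    (f := fun y : EuclideanSpace ℝ (Fin 3) => F (y 0, √(y 0 ^ 2 + y 1 ^ 2 + y 2 ^ 2)))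
    (by fun_prop)
  have e2 := (PiLp.volume_preserving_ofLp (Fin 3)).lintegral_comp
    (f := fun y : Fin 3 → ℝ => F (y 0, √(y 0 ^ 2 + y 1 ^ 2 + y 2 ^ 2))) (by fun_prop)
  have e3 := (volume_preserving_piFinSuccAbove (fun _ : Fin 3 => ℝ) 0).lintegral_comp
    (f := fun y : ℝ × (Fin 2 → ℝ) => F (y.1, √(y.1 ^ 2 + y.2 0 ^ 2 + y.2 1 ^ 2)))
    (by fun_prop)
  rw [e1, e2]
  refine (e3.trans (c := ∫⁻ x : ℝ, ∫⁻ p : ℝ × ℝ,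
    F (x, √(x ^ 2 + p.1 ^ 2 + p.2 ^ 2))) ?_).trans_le ?_
  · rw [Measure.volume_eq_prod, lintegral_prod _ (by fun_prop)]
    refine lintegral_congr fun x => ?_
    exact (volume_preserving_finTwoArrow ℝ).lintegral_comp
      (f := fun p : ℝ × ℝ => F (x, √(x ^ 2 + p.1 ^ 2 + p.2 ^ 2))) (by fun_prop)
  · rw [← lintegral_const_mul _ (by fun_prop)]
    exact lintegral_mono fun x => lintegral_plane_comp_sqrt_le x (h := fun r => F (x, r))
      (by fun_prop)

lemma lintegral_gaussian_affine {a : ℝ} (ha : 0 < a) (r : ℝ) :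
    ∫⁻ x : ℝ, ENNReal.ofReal (exp (-(r + a * x) ^ 2 / 8)) = ENNReal.ofReal (√(8 * π) / a) := by
  have hint : Integrable fun y : ℝ => exp (-(1 / 8) * y ^ 2) :=
    integrable_exp_neg_mul_sq (by norm_num)
  have heq : (fun x : ℝ => exp (-(r + a * x) ^ 2 / 8))
      = fun x => (fun y => exp (-(1 / 8) * (r + y) ^ 2)) (a * x) := by
    funext x
    dsimp only
    ring_nf
  rw [← ofReal_integral_eq_lintegral_ofReal _ (ae_of_all _ fun x => (exp_pos _).le), heq,
    Measure.integral_comp_mul_left (fun y => exp (-(1 / 8) * (r + y) ^ 2)) a,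
    integral_add_left_eq_self (fun y : ℝ => exp (-(1 / 8) * y ^ 2)) r, integral_gaussian,
    abs_of_pos (inv_pos.2 ha), smul_eq_mul]
  · congr 1
    rw [show π / (1 / 8) = 8 * π by ring]
    field_simp
  · rw [heq]
    exact (hint.comp_add_left r).comp_mul_left' ha.ne'

/-- The Gaussian factor of the Grad kernel, integrated over `|x| ≤ r` where `x` is the component
along `v` and `V = ‖v‖`, gains a factor `(1 + V)⁻¹`. -/
lemma lintegral_slice_le {V r : ℝ} (hV : 0 ≤ V) (hr : 0 < r) :
    ∫⁻ x in Icc (-r) r, ENNReal.ofReal (exp (-(r + 2 * V * x / r) ^ 2 / 8))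
      ≤ ENNReal.ofReal ((4 + √(8 * π)) * (1 + V)⁻¹ * r) := by
  have hs : 0 ≤ √(8 * π) := Real.sqrt_nonneg _
  rcases le_total V 1 with h1 | h1
  · calc _ ≤ ∫⁻ x in Icc (-r) r, 1 := by
          refine lintegral_mono fun x => ?_
          rw [ENNReal.ofReal_le_one, exp_le_one_iff]
          have := sq_nonneg (r + 2 * V * x / r)
          linarith
      _ = ENNReal.ofReal (2 * r) := by
          rw [setLIntegral_one, Real.volume_Icc]
          congr 1
          ring
      _ ≤ _ := by
          refine ENNReal.ofReal_le_ofReal (mul_le_mul_of_nonneg_right ?_ hr.le)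
          rw [← div_eq_mul_inv, le_div_iff₀ (by linarith)]
          linarith
  · have hV' : 0 < V := by linarith
    calc _ ≤ ∫⁻ x : ℝ, ENNReal.ofReal (exp (-(r + 2 * V * x / r) ^ 2 / 8)) :=
          setLIntegral_le_lintegral _ _
      _ = ENNReal.ofReal (√(8 * π) / (2 * V / r)) := by
          rw [← lintegral_gaussian_affine (by positivity) r]
          simp_rw [mul_div_right_comm]
      _ ≤ _ := by
          apply ENNReal.ofReal_le_ofReal
          rw [div_div_eq_mul_div, mul_div_right_comm]
          refine mul_le_mul_of_nonneg_right ?_ hr.le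
          rw [← div_eq_mul_inv]
          gcongr <;> linarith

/-- Classical estimate for the Grad kernel of the linearized Boltzmann operator with
hard potentials and cutoff: `∫ k(v,v*) dv* ≤ C (1+|v|)⁻¹`. -/
theorem grad_kernel_integral_estimate (γ c : ℝ) (hγ : γ ∈ Set.Icc (0:ℝ) 1) (hc : 0 < c) :
    ∃ C > 0, ∀ v : EuclideanSpace ℝ (Fin 3),
      (∫⁻ w : EuclideanSpace ℝ (Fin 3),
        ENNReal.ofReal (c * ‖v - w‖ ^ (γ - 2) *
          Real.exp (-‖v - w‖ ^ 2 / 8 -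
            (‖v‖ ^ 2 - ‖w‖ ^ 2) ^ 2 / (8 * ‖v - w‖ ^ 2))))
        ≤ ENNReal.ofReal (C * (1 + ‖v‖)⁻¹) := by
  obtain ⟨hγ0, -⟩ := hγ
  set K : ℝ≥0∞ := ∫⁻ r in Ioi (0 : ℝ), ENNReal.ofReal (r ^ γ * exp (-(1 / 8) * r ^ 2)) with hK
  have hKtop : K ≠ ∞ :=
    ((integrableOn_rpow_mul_exp_neg_mul_sq (b := 1 / 8) (by norm_num)
      (by linarith : -1 < γ)).lintegral_lt_top).ne
  have hD : 0 < 4 + √(8 * π) := by positivity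
  refine ⟨2 * π * (c * (4 + √(8 * π))) * K.toReal + 1, by positivity, fun v => ?_⟩
  obtain ⟨e, he, hv⟩ : ∃ e : EuclideanSpace ℝ (Fin 3), ‖e‖ = 1 ∧ v = ‖v‖ • e := by
    rcases eq_or_ne v 0 with rfl | h
    · obtain ⟨e, he⟩ := exists_norm_eq (EuclideanSpace ℝ (Fin 3)) zero_le_one
      exact ⟨e, he, by simp⟩
    · exact ⟨‖v‖⁻¹ • v, norm_smul_inv_norm (𝕜 := ℝ) h,
        (smul_inv_smul₀ (norm_ne_zero_iff.2 h) v).symm⟩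
  set V := ‖v‖ with hVdef
  have hV : 0 ≤ V := norm_nonneg v
  set A : ℝ → ℝ≥0∞ := fun r => ENNReal.ofReal (c * r ^ (γ - 2) * exp (-r ^ 2 / 8)) with hA
  set G : ℝ × ℝ → ℝ≥0∞ := {p : ℝ × ℝ | -p.2 ≤ p.1 ∧ p.1 ≤ p.2}.indicator
    (fun p => ENNReal.ofReal (exp (-(p.2 + 2 * V * p.1 / p.2) ^ 2 / 8))) with hG
  have hAm : Measurable A := by fun_prop
  have hGm : Measurable G := by
    refine Measurable.indicator (by fun_prop) ?_
    exact (measurableSet_le measurable_snd.neg measurable_fst).inter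
      (measurableSet_le measurable_fst measurable_snd)
  have kernel : ∀ z : EuclideanSpace ℝ (Fin 3),
      ENNReal.ofReal (c * ‖v - (v + z)‖ ^ (γ - 2) *
          Real.exp (-‖v - (v + z)‖ ^ 2 / 8 -
            (V ^ 2 - ‖v + z‖ ^ 2) ^ 2 / (8 * ‖v - (v + z)‖ ^ 2)))
        = A ‖z‖ * G (inner ℝ e z, ‖z‖) := fun z => by
    have hmem : -‖z‖ ≤ inner ℝ e z ∧ inner ℝ e z ≤ ‖z‖ := by
      have := abs_real_inner_le_norm e z
      rw [he, one_mul] at this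
      exact abs_le.1 this
    have hsq : ‖v + z‖ ^ 2 = V ^ 2 + 2 * (V * inner ℝ e z) + ‖z‖ ^ 2 := by
      rw [norm_add_sq_real, ← hVdef]
      congr 3
      conv_lhs => rw [hv]
      rw [real_inner_smul_left]
    rw [sub_add_cancel_left, norm_neg, hsq, hG, Set.indicator_of_mem (by exact hmem), hA,
      ← ENNReal.ofReal_mul (by positivity), mul_assoc _ (exp _), ← Real.exp_add]
    congr 3
    rcases (norm_nonneg z).eq_or_lt with h0 | h0
    · simp [← h0]
    · field_simp
      ring
  have slice : ∀ r ∈ Ioi (0 : ℝ), ∫⁻ x, ENNReal.ofReal r * (A r * G (x, r))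
      ≤ ENNReal.ofReal (c * (4 + √(8 * π)) * (1 + V)⁻¹) *
        ENNReal.ofReal (r ^ γ * exp (-(1 / 8) * r ^ 2)) := fun r hr => by
    have hr' : 0 < r := hr
    have hGr : ∫⁻ x, G (x, r)
        = ∫⁻ x in Icc (-r) r, ENNReal.ofReal (exp (-(r + 2 * V * x / r) ^ 2 / 8)) := by
      rw [← lintegral_indicator measurableSet_Icc]
      rfl
    rw [lintegral_const_mul _ (by fun_prop), lintegral_const_mul _ (by fun_prop), hGr]
    calc _ ≤ ENNReal.ofReal r * (A r * ENNReal.ofReal ((4 + √(8 * π)) * (1 + V)⁻¹ * r)) := by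
          gcongr
          exact lintegral_slice_le hV hr'
      _ = _ := by
          rw [hA, ← ENNReal.ofReal_mul (by positivity), ← ENNReal.ofReal_mul (by positivity),
            ← ENNReal.ofReal_mul (by positivity)]
          have hpow : r ^ γ = r ^ (γ - 2) * r ^ 2 := by
            rw [← Real.rpow_natCast r 2, ← Real.rpow_add hr']
            norm_num
          rw [hpow, show -r ^ 2 / 8 = -(1 / 8) * r ^ 2 by ring]
          congr 1
          ring
  rw [← lintegral_add_left_eq_self _ v]
  simp_rw [kernel]
  calc ∫⁻ z, A ‖z‖ * G (inner ℝ e z, ‖z‖)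
      ≤ ENNReal.ofReal (2 * π) *
          ∫⁻ x : ℝ, ∫⁻ r in Ioi (0 : ℝ), ENNReal.ofReal r * (A r * G (x, r)) :=
        lintegral_comp_inner_norm_le he (F := fun p => A p.2 * G p) (by fun_prop)
    _ = ENNReal.ofReal (2 * π) *
          ∫⁻ r in Ioi (0 : ℝ), ∫⁻ x : ℝ, ENNReal.ofReal r * (A r * G (x, r)) := by
        rw [lintegral_lintegral_swap]
        unfold Function.uncurry
        fun_prop
    _ ≤ ENNReal.ofReal (2 * π) *
          (ENNReal.ofReal (c * (4 + √(8 * π)) * (1 + V)⁻¹) * K) := by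
        refine mul_le_mul_right ?_ _
        rw [hK, ← lintegral_const_mul _ (by fun_prop)]
        exact setLIntegral_mono (by fun_prop) slice
    _ = ENNReal.ofReal (2 * π * (c * (4 + √(8 * π))) * K.toReal * (1 + V)⁻¹) := by
        rw [← ENNReal.ofReal_toReal hKtop, ENNReal.toReal_ofReal ENNReal.toReal_nonneg,
          ← ENNReal.ofReal_mul (by positivity), ← ENNReal.ofReal_mul (by positivity)]
        congr 1
        ring
    _ ≤ _ := by
        gcongr
        linarith
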